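/- arXiv:cs/0505003 — 10 statements merged into one kernel-verified Lean document; each statement's English description precedes it below -/
import Mathlib

section
/- Suppose the cooperative optimization iterates are started from c^{(0)} = 0. Then for every iteration step k ≥ 1 and every assignment x : ∀ i, D i, one has Σ_i c^{(k)}_i(x i) ≤ E(x); that is, the function x ↦ Σ_i c^{(k)}_i(x i) is a lower bound function on the objective E. -/
/-- Started from `c⁽⁰⁾ = 0`, for every `k ≥ 1` and every assignment `x`,
`∑ i, c⁽ᵏ⁾ᵢ(x i) ≤ E(x)`, i.e. `x ↦ ∑ i, c⁽ᵏ⁾ᵢ(x i)` is a lower bound function on `E`. -/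
theorem stmt_0
    (n : ℕ) (hn : 1 ≤ n)
    (D : Fin n → Type) [∀ i, Fintype (D i)] [∀ i, Nonempty (D i)]
    (E : Fin n → (∀ i, D i) → ℝ)
    (hE : ∀ i x, 0 ≤ E i x)
    (W : Matrix (Fin n) (Fin n) ℝ)
    (hWnn : ∀ i j, 0 ≤ W i j)
    (hWcol : ∀ j, ∑ i, W i j = 1)
    (hWirr : ∀ i j, ∃ k, 0 < (W ^ k) i j)
    (lam : ℕ → ℝ)
    (hlam : ∀ k, 1 ≤ k → 0 ≤ lam k ∧ lam k < 1)
    (c : ℕ → ∀ i, D i → ℝ)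
    (hc0 : ∀ i a, c 0 i a = 0)
    (hrec : ∀ k, 1 ≤ k → ∀ i a,
      c k i a = ⨅ x : {x : ∀ j, D j // x i = a},
        ((1 - lam k) * E i x.1 + lam k * ∑ j, W i j * c (k - 1) j (x.1 j))) :
    ∀ k, 1 ≤ k → ∀ x : ∀ i, D i, ∑ i, c k i (x i) ≤ ∑ i, E i x := by
  have key : ∀ k, ∀ x : ∀ i, D i, ∑ i, c k i (x i) ≤ ∑ i, E i x := by
    intro k
    induction k with
    | zero =>
      intro x
      simp only [hc0, Finset.sum_const_zero]
      exact Finset.sum_nonneg fun i _ => hE i x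
    | succ k ih =>
      intro x
      obtain ⟨h0, h1⟩ := hlam (k + 1) (by omega)
      have hle : ∀ i, c (k + 1) i (x i) ≤
          (1 - lam (k + 1)) * E i x + lam (k + 1) * ∑ j, W i j * c k j (x j) := by
        intro i
        rw [hrec (k + 1) (by omega) i (x i)]
        exact ciInf_le (Set.finite_range _).bddBelow
          (⟨x, rfl⟩ : {y : ∀ j, D j // y i = x i})
      have hsw : ∑ i, ∑ j, W i j * c k j (x j) = ∑ j, c k j (x j) := by
        rw [Finset.sum_comm]
        refine Finset.sum_congr rfl fun j _ => ?_
        rw [← Finset.sum_mul, hWcol, one_mul]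
      calc ∑ i, c (k + 1) i (x i)
          ≤ ∑ i, ((1 - lam (k + 1)) * E i x
              + lam (k + 1) * ∑ j, W i j * c k j (x j)) :=
            Finset.sum_le_sum fun i _ => hle i
        _ = (1 - lam (k + 1)) * ∑ i, E i x + lam (k + 1) * ∑ j, c k j (x j) := by
            rw [Finset.sum_add_distrib, ← Finset.mul_sum, ← Finset.mul_sum, hsw]
        _ ≤ ∑ i, E i x := by
            have := mul_le_mul_of_nonneg_left (ih x) h0
            linarith
  exact fun k _ x => key k x
end

section
/- Suppose the cooperative optimization iterates are started from c^{(0)} = 0. Then for every iteration step k ≥ 1, the quantity E*_-^{(k)} = Σ_i min_{a ∈ D i} c^{(k)}_i(a) is a lower bound on the optimal value: E*_-^{(k)} ≤ E*. -/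
/-- Started from `c⁽⁰⁾ = 0`, for every `k ≥ 1`, the quantity
`E*₋⁽ᵏ⁾ = ∑ i, min_{a ∈ D i} c⁽ᵏ⁾ᵢ(a)` is a lower bound on the optimal value `E*`. -/
theorem stmt_1
    (n : ℕ) (hn : 1 ≤ n)
    (D : Fin n → Type) [∀ i, Fintype (D i)] [∀ i, Nonempty (D i)]
    (E : Fin n → (∀ i, D i) → ℝ)
    (hE : ∀ i x, 0 ≤ E i x)
    (W : Matrix (Fin n) (Fin n) ℝ)
    (hWnn : ∀ i j, 0 ≤ W i j)
    (hWcol : ∀ j, ∑ i, W i j = 1)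
    (hWirr : ∀ i j, ∃ k, 0 < (W ^ k) i j)
    (lam : ℕ → ℝ)
    (hlam : ∀ k, 1 ≤ k → 0 ≤ lam k ∧ lam k < 1)
    (c : ℕ → ∀ i, D i → ℝ)
    (hc0 : ∀ i a, c 0 i a = 0)
    (hrec : ∀ k, 1 ≤ k → ∀ i a,
      c k i a = ⨅ x : {x : ∀ j, D j // x i = a},
        ((1 - lam k) * E i x.1 + lam k * ∑ j, W i j * c (k - 1) j (x.1 j)))
    (Estar : ℝ) (hEstar : Estar = ⨅ x : ∀ i, D i, ∑ i, E i x) :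
    ∀ k, 1 ≤ k → (∑ i, ⨅ a : D i, c k i a) ≤ Estar := by
  have key : ∀ k, ∀ x : (∀ i, D i), ∑ i, c k i (x i) ≤ ∑ i, E i x := by
    intro k
    induction k with
    | zero =>
      intro x
      simp only [hc0, Finset.sum_const_zero]
      exact Finset.sum_nonneg fun i _ => hE i x
    | succ k ih =>
      intro x
      obtain ⟨h0, h1⟩ := hlam (k + 1) (by omega)
      have hle : ∀ i, c (k + 1) i (x i) ≤
          (1 - lam (k + 1)) * E i x + lam (k + 1) * ∑ j, W i j * c k j (x j) := by
        intro i
        rw [hrec (k + 1) (by omega) i (x i)]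
        exact ciInf_le (f := fun y : {y : ∀ j, D j // y i = x i} =>
          (1 - lam (k + 1)) * E i y.1 + lam (k + 1) * ∑ j, W i j * c k j (y.1 j))
          (Set.finite_range _).bddBelow ⟨x, rfl⟩
      have hsum : ∑ i, ∑ j, W i j * c k j (x j) = ∑ j, c k j (x j) := by
        rw [Finset.sum_comm]
        refine Finset.sum_congr rfl fun j _ => ?_
        rw [← Finset.sum_mul, hWcol, one_mul]
      calc ∑ i, c (k + 1) i (x i)
          ≤ ∑ i, ((1 - lam (k + 1)) * E i x + lam (k + 1) * ∑ j, W i j * c k j (x j)) :=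
            Finset.sum_le_sum fun i _ => hle i
        _ = (1 - lam (k + 1)) * ∑ i, E i x + lam (k + 1) * ∑ j, c k j (x j) := by
            rw [Finset.sum_add_distrib, ← Finset.mul_sum, ← Finset.mul_sum, hsum]
        _ ≤ ∑ i, E i x := by
            have := mul_le_mul_of_nonneg_left (ih x) h0
            linarith
  intro k _
  rw [hEstar]
  refine le_ciInf fun x => le_trans (Finset.sum_le_sum fun i _ => ?_) (key k x)
  exact ciInf_le (Set.finite_range _).bddBelow (x i)
end

section
/- Suppose the cooperation strength is a constant λ ∈ [0,1) (λ_k = λ for all k) and the iterates are started from c^{(0)} = 0. Then the sequence of lower bounds (E*_-^{(k)})_{k ≥ 0} is non-decreasing in k and is bounded above by the optimal value E*: for all k, E*_-^{(k)} ≤ E*_-^{(k+1)} and E*_-^{(k)} ≤ E*. -/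
/-- With a constant cooperation strength `λ ∈ [0,1)` and `c⁽⁰⁾ = 0`,
the sequence of lower bounds `E*₋⁽ᵏ⁾ = ∑ i, min_a c⁽ᵏ⁾ᵢ(a)` is non-decreasing in `k`
and bounded above by the optimal value `E*`. -/
theorem stmt_2
    (n : ℕ) (hn : 1 ≤ n)
    (D : Fin n → Type) [∀ i, Fintype (D i)] [∀ i, Nonempty (D i)]
    (E : Fin n → (∀ i, D i) → ℝ)
    (hE : ∀ i x, 0 ≤ E i x)
    (W : Matrix (Fin n) (Fin n) ℝ)
    (hWnn : ∀ i j, 0 ≤ W i j)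
    (hWcol : ∀ j, ∑ i, W i j = 1)
    (hWirr : ∀ i j, ∃ k, 0 < (W ^ k) i j)
    (lam : ℝ)
    (hlam : 0 ≤ lam ∧ lam < 1)
    (c : ℕ → ∀ i, D i → ℝ)
    (hc0 : ∀ i a, c 0 i a = 0)
    (hrec : ∀ k, 1 ≤ k → ∀ i a,
      c k i a = ⨅ x : {x : ∀ j, D j // x i = a},
        ((1 - lam) * E i x.1 + lam * ∑ j, W i j * c (k - 1) j (x.1 j)))
    (Estar : ℝ) (hEstar : Estar = ⨅ x : ∀ i, D i, ∑ i, E i x) :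
    ∀ k : ℕ, (∑ i, ⨅ a : D i, c k i a) ≤ (∑ i, ⨅ a : D i, c (k + 1) i a) ∧
      (∑ i, ⨅ a : D i, c k i a) ≤ Estar := by
  classical
  obtain ⟨hl0, hl1⟩ := hlam
  have hrec' : ∀ k i a, c (k + 1) i a = ⨅ x : {x : ∀ j, D j // x i = a},
        ((1 - lam) * E i x.1 + lam * ∑ j, W i j * c k j (x.1 j)) := by
    intro k i a
    simpa using hrec (k + 1) (by omega) i a
  have hne : ∀ i (a : D i), Nonempty {x : ∀ j, D j // x i = a} := by
    intro i a
    exact ⟨⟨Function.update (fun j => Classical.arbitrary (D j)) i a, by simp⟩⟩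
  have hle : ∀ k i (x : ∀ j, D j),
      c (k + 1) i (x i) ≤ (1 - lam) * E i x + lam * ∑ j, W i j * c k j (x j) := by
    intro k i x
    rw [hrec']
    exact ciInf_le (Set.finite_range (fun y : {y : ∀ j, D j // y i = x i} =>
      (1 - lam) * E i y.1 + lam * ∑ j, W i j * c k j (y.1 j))).bddBelow ⟨x, rfl⟩
  have hmono : ∀ k i a, c k i a ≤ c (k + 1) i a := by
    intro k
    induction k with
    | zero =>
      intro i a
      haveI := hne i a
      rw [hrec', hc0]
      refine le_ciInf fun x => ?_
      simp only [hc0, mul_zero, Finset.sum_const_zero, add_zero]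
      exact mul_nonneg (by linarith) (hE i x.1)
    | succ k ih =>
      intro i a
      haveI := hne i a
      rw [hrec' (k + 1)]
      refine le_ciInf fun x => ?_
      obtain ⟨x, rfl⟩ := x
      refine (hle k i x).trans ?_
      have : ∑ j, W i j * c k j (x j) ≤ ∑ j, W i j * c (k + 1) j (x j) :=
        Finset.sum_le_sum fun j _ => mul_le_mul_of_nonneg_left (ih j (x j)) (hWnn i j)
      have := mul_le_mul_of_nonneg_left this hl0
      simpa using this
  have hub : ∀ k (x : ∀ j, D j), ∑ i, c k i (x i) ≤ ∑ i, E i x := by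
    intro k x
    induction k with
    | zero =>
      simp only [hc0]
      exact Finset.sum_le_sum fun i _ => hE i x
    | succ k ih =>
      have h1 : ∑ i, c (k + 1) i (x i) ≤
          ∑ i, ((1 - lam) * E i x + lam * ∑ j, W i j * c k j (x j)) :=
        Finset.sum_le_sum fun i _ => hle k i x
      have h2 : ∑ i, ∑ j, W i j * c k j (x j) = ∑ j, c k j (x j) := by
        rw [Finset.sum_comm]
        refine Finset.sum_congr rfl fun j _ => ?_
        rw [← Finset.sum_mul, hWcol, one_mul]
      rw [Finset.sum_add_distrib, ← Finset.mul_sum, ← Finset.mul_sum, h2] at h1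
      nlinarith [mul_le_mul_of_nonneg_left ih hl0]
  intro k
  constructor
  · exact Finset.sum_le_sum fun i _ =>
      ciInf_mono (Set.finite_range _).bddBelow (hmono k i)
  · rw [hEstar]
    refine le_ciInf fun x => le_trans ?_ (hub k x)
    exact Finset.sum_le_sum fun i _ => ciInf_le (Set.finite_range _).bddBelow (x i)
end

section
/- Suppose the cooperative optimization iterates are started from c^{(0)} = 0, and suppose there are steps 1 ≤ k₁ ≤ k₂ and an assignment x̃ that is a consensus solution at every step k with k₁ ≤ k ≤ k₂. Then 0 ≤ E(x̃) − E* ≤ (∏_{k=k₁}^{k₂} λ_k) · (E(x̃) − E*_-^{(k₁−1)}). -/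
/-- Started from `c⁽⁰⁾ = 0`, if `x̃` is a consensus solution at every step
`k` with `k₁ ≤ k ≤ k₂` (where `1 ≤ k₁ ≤ k₂`), then
`0 ≤ E(x̃) − E* ≤ (∏_{k=k₁}^{k₂} λ_k) · (E(x̃) − E*₋^{(k₁−1)})`. -/
theorem stmt_3
    (n : ℕ) (hn : 1 ≤ n)
    (D : Fin n → Type) [∀ i, Fintype (D i)] [∀ i, Nonempty (D i)]
    (E : Fin n → (∀ i, D i) → ℝ)
    (hE : ∀ i x, 0 ≤ E i x)
    (W : Matrix (Fin n) (Fin n) ℝ)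
    (hWnn : ∀ i j, 0 ≤ W i j)
    (hWcol : ∀ j, ∑ i, W i j = 1)
    (hWirr : ∀ i j, ∃ k, 0 < (W ^ k) i j)
    (lam : ℕ → ℝ)
    (hlam : ∀ k, 1 ≤ k → 0 ≤ lam k ∧ lam k < 1)
    (c : ℕ → ∀ i, D i → ℝ)
    (hc0 : ∀ i a, c 0 i a = 0)
    (hrec : ∀ k, 1 ≤ k → ∀ i a,
      c k i a = ⨅ x : {x : ∀ j, D j // x i = a},
        ((1 - lam k) * E i x.1 + lam k * ∑ j, W i j * c (k - 1) j (x.1 j)))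
    (Estar : ℝ) (hEstar : Estar = ⨅ x : ∀ i, D i, ∑ i, E i x)
    (k₁ k₂ : ℕ) (hk₁ : 1 ≤ k₁) (hk₁k₂ : k₁ ≤ k₂)
    (xt : ∀ i, D i)
    (hcons : ∀ k, k₁ ≤ k → k ≤ k₂ → ∀ i,
      ((1 - lam k) * E i xt + lam k * ∑ j, W i j * c (k - 1) j (xt j)) =
        ⨅ x : ∀ j, D j,
          ((1 - lam k) * E i x + lam k * ∑ j, W i j * c (k - 1) j (x j))) :
    0 ≤ (∑ i, E i xt) - Estar ∧
      (∑ i, E i xt) - Estar ≤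
        (∏ k ∈ Finset.Icc k₁ k₂, lam k) *
          ((∑ i, E i xt) - ∑ i, ⨅ a : D i, c (k₁ - 1) i a) := by
  have bdd : ∀ {α : Type} [Finite α] (f : α → ℝ), BddBelow (Set.range f) :=
    fun f => (Set.finite_range f).bddBelow
  -- the sum of the modified sub-objectives
  have hsum : ∀ k x, ∑ i, ((1 - lam k) * E i x + lam k * ∑ j, W i j * c (k - 1) j (x j))
      = (1 - lam k) * ∑ i, E i x + lam k * ∑ j, c (k - 1) j (x j) := by
    intro k x
    rw [Finset.sum_add_distrib, ← Finset.mul_sum, ← Finset.mul_sum, Finset.sum_comm]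
    congr 2
    refine Finset.sum_congr rfl fun j _ => ?_
    rw [← Finset.sum_mul, hWcol, one_mul]
  have hcle : ∀ k, 1 ≤ k → ∀ i x, c k i (x i) ≤
      (1 - lam k) * E i x + lam k * ∑ j, W i j * c (k - 1) j (x j) := by
    intro k hk i x
    rw [hrec k hk i (x i)]
    exact ciInf_le (bdd (fun y : {y : ∀ j, D j // y i = x i} =>
      ((1 - lam k) * E i y.1 + lam k * ∑ j, W i j * c (k - 1) j (y.1 j)))) ⟨x, rfl⟩
  -- lower bound
  have hlow : ∀ k x, ∑ i, c k i (x i) ≤ ∑ i, E i x := by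
    intro k
    induction k with
    | zero =>
      intro x
      exact Finset.sum_le_sum fun i _ => by rw [hc0]; exact hE i x
    | succ k ih =>
      intro x
      have h1 := Finset.sum_le_sum fun i (_ : i ∈ Finset.univ) =>
        hcle (k + 1) (Nat.le_add_left 1 k) i x
      rw [hsum] at h1
      have h2 := ih x
      have h3 := mul_le_mul_of_nonneg_left h2 (hlam (k + 1) (Nat.le_add_left 1 k)).1
      simp only [Nat.add_sub_cancel] at h1
      linarith
  -- consensus
  have hmin : ∀ k, k₁ ≤ k → k ≤ k₂ → ∀ i a,
      (1 - lam k) * E i xt + lam k * ∑ j, W i j * c (k - 1) j (xt j) ≤ c k i a := by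
    intro k h1 h2 i a
    rw [hrec k (hk₁.trans h1) i a, hcons k h1 h2 i]
    classical
    haveI : Nonempty {x : ∀ j, D j // x i = a} :=
      ⟨⟨Function.update xt i a, by simp⟩⟩
    refine le_ciInf fun y => ?_
    exact ciInf_le (bdd (fun x : ∀ j, D j =>
      ((1 - lam k) * E i x + lam k * ∑ j, W i j * c (k - 1) j (x j)))) y.1
  have hstep : ∀ k, k₁ ≤ k → k ≤ k₂ →
      (∑ i, E i xt) - ∑ i, c k i (xt i)
        = lam k * ((∑ i, E i xt) - ∑ i, c (k - 1) i (xt i)) := by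
    intro k h1 h2
    have h : ∑ i, c k i (xt i) = _ := (Finset.sum_congr rfl fun i _ =>
      le_antisymm (hcle k (hk₁.trans h1) i xt) (hmin k h1 h2 i (xt i))).trans (hsum k xt)
    rw [h]; ring
  have hprod : ∀ k, k₁ ≤ k → k ≤ k₂ →
      (∑ i, E i xt) - ∑ i, c k i (xt i)
        = (∏ k ∈ Finset.Icc k₁ k, lam k) *
          ((∑ i, E i xt) - ∑ i, c (k₁ - 1) i (xt i)) := by
    intro k hk
    induction k, hk using Nat.le_induction with
    | base => intro h; rw [hstep k₁ le_rfl h]; simp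
    | succ k hk ih =>
      intro h
      rw [hstep (k + 1) (by omega) h, Nat.add_sub_cancel, ih (by omega),
        Finset.prod_Icc_succ_top (by omega)]
      ring
  have hS : ∑ i, c k₂ i (xt i) ≤ Estar := by
    rw [hEstar]
    refine le_ciInf fun x => le_trans (Finset.sum_le_sum fun i _ => ?_) (hlow k₂ x)
    exact (hcle k₂ (hk₁.trans hk₁k₂) i xt).trans (hmin k₂ hk₁k₂ le_rfl i (x i))
  refine ⟨?_, ?_⟩
  · rw [hEstar, sub_nonneg]
    exact ciInf_le (bdd (fun x : ∀ i, D i => ∑ i, E i x)) xt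
  · have h1 := hprod k₂ hk₁k₂ le_rfl
    have h2 : ∑ i, (⨅ a : D i, c (k₁ - 1) i a) ≤ ∑ i, c (k₁ - 1) i (xt i) :=
      Finset.sum_le_sum fun i _ => ciInf_le (bdd (fun a => c (k₁ - 1) i a)) (xt i)
    have h3 : 0 ≤ ∏ k ∈ Finset.Icc k₁ k₂, lam k :=
      Finset.prod_nonneg fun k hk => (hlam k (hk₁.trans (Finset.mem_Icc.1 hk).1)).1
    have h4 := mul_le_mul_of_nonneg_left (sub_le_sub_left h2 (∑ i, E i xt)) h3
    linarith
end

section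
/- Suppose the cooperative optimization iterates are started from c^{(0)} = 0, and suppose there are steps 1 ≤ k₁ ≤ k₂ and an assignment x̃ that is a consensus solution at every step k with k₁ ≤ k ≤ k₂. Let P = ∏_{k=k₁}^{k₂} λ_k (note P < 1). Then 0 ≤ E(x̃) − E* ≤ (P / (1 − P)) · (E* − E*_-^{(k₁−1)}). -/
/-- Started from `c⁽⁰⁾ = 0`, if `x̃` is a consensus solution at every step
`k` with `k₁ ≤ k ≤ k₂` (where `1 ≤ k₁ ≤ k₂`), and `P = ∏_{k=k₁}^{k₂} λ_k`, then
`0 ≤ E(x̃) − E* ≤ (P/(1−P)) · (E* − E*₋^{(k₁−1)})`. -/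
theorem stmt_4
    (n : ℕ) (hn : 1 ≤ n)
    (D : Fin n → Type) [∀ i, Fintype (D i)] [∀ i, Nonempty (D i)]
    (E : Fin n → (∀ i, D i) → ℝ)
    (hE : ∀ i x, 0 ≤ E i x)
    (W : Matrix (Fin n) (Fin n) ℝ)
    (hWnn : ∀ i j, 0 ≤ W i j)
    (hWcol : ∀ j, ∑ i, W i j = 1)
    (hWirr : ∀ i j, ∃ k, 0 < (W ^ k) i j)
    (lam : ℕ → ℝ)
    (hlam : ∀ k, 1 ≤ k → 0 ≤ lam k ∧ lam k < 1)
    (c : ℕ → ∀ i, D i → ℝ)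
    (hc0 : ∀ i a, c 0 i a = 0)
    (hrec : ∀ k, 1 ≤ k → ∀ i a,
      c k i a = ⨅ x : {x : ∀ j, D j // x i = a},
        ((1 - lam k) * E i x.1 + lam k * ∑ j, W i j * c (k - 1) j (x.1 j)))
    (Estar : ℝ) (hEstar : Estar = ⨅ x : ∀ i, D i, ∑ i, E i x)
    (k₁ k₂ : ℕ) (hk₁ : 1 ≤ k₁) (hk₁k₂ : k₁ ≤ k₂)
    (xt : ∀ i, D i)
    (hcons : ∀ k, k₁ ≤ k → k ≤ k₂ → ∀ i,
      ((1 - lam k) * E i xt + lam k * ∑ j, W i j * c (k - 1) j (xt j)) =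
        ⨅ x : ∀ j, D j,
          ((1 - lam k) * E i x + lam k * ∑ j, W i j * c (k - 1) j (x j)))
    (P : ℝ) (hP : P = ∏ k ∈ Finset.Icc k₁ k₂, lam k) :
    0 ≤ (∑ i, E i xt) - Estar ∧
      (∑ i, E i xt) - Estar ≤
        (P / (1 - P)) * (Estar - ∑ i, ⨅ a : D i, c (k₁ - 1) i a) := by
  classical
  obtain ⟨r, rfl⟩ : ∃ r, k₁ = r + 1 := ⟨k₁ - 1, by omega⟩
  simp only [Nat.add_sub_cancel] at *
  have bdd : ∀ {ι : Type} [Finite ι] (f : ι → ℝ), BddBelow (Set.range f) :=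
    fun f => (Set.finite_range f).bddBelow
  -- column sums
  have hcol : ∀ k (x : ∀ i, D i),
      ∑ i, ∑ j, W i j * c k j (x j) = ∑ j, c k j (x j) := by
    intro k x
    rw [Finset.sum_comm]
    refine Finset.sum_congr rfl fun j _ => ?_
    rw [← Finset.sum_mul, hWcol, one_mul]
  have htot : ∀ k (x : ∀ i, D i),
      ∑ i, ((1 - lam (k + 1)) * E i x + lam (k + 1) * ∑ j, W i j * c k j (x j)) =
        (1 - lam (k + 1)) * ∑ i, E i x + lam (k + 1) * ∑ j, c k j (x j) := by
    intro k x
    rw [Finset.sum_add_distrib, ← Finset.mul_sum, ← Finset.mul_sum, hcol]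
  have hle : ∀ k i (x : ∀ i, D i), c (k + 1) i (x i) ≤
      (1 - lam (k + 1)) * E i x + lam (k + 1) * ∑ j, W i j * c k j (x j) := by
    intro k i x
    rw [hrec (k + 1) (by omega) i (x i)]
    exact ciInf_le (bdd _) (⟨x, rfl⟩ : {y : ∀ j, D j // y i = x i})
  have hS : ∀ k (x : ∀ i, D i), ∑ i, c k i (x i) ≤ ∑ i, E i x := by
    intro k x
    induction k with
    | zero => simpa [hc0] using Finset.sum_nonneg fun i _ => hE i x
    | succ k ih =>
      have h1 := Finset.sum_le_sum fun i (_ : i ∈ Finset.univ) => hle k i x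
      rw [htot] at h1
      have h2 := mul_le_mul_of_nonneg_left ih (hlam (k + 1) (by omega)).1
      linarith
  -- consensus values
  have hmin : ∀ k, r + 1 ≤ k + 1 → k + 1 ≤ k₂ → ∀ i a,
      (1 - lam (k + 1)) * E i xt + lam (k + 1) * ∑ j, W i j * c k j (xt j)
        ≤ c (k + 1) i a := by
    intro k h1 h2 i a
    rw [hrec (k + 1) (by omega) i a]
    haveI : Nonempty {x : ∀ j, D j // x i = a} :=
      ⟨⟨Function.update xt i a, by simp⟩⟩
    refine le_ciInf fun x => ?_
    have := hcons (k + 1) h1 h2 i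
    simp only [Nat.add_sub_cancel] at this
    rw [this]
    exact ciInf_le (bdd (fun x : ∀ j, D j =>
      (1 - lam (k + 1)) * E i x + lam (k + 1) * ∑ j, W i j * c k j (x j))) x.1
  have hdiff : ∀ m, r ≤ m → m ≤ k₂ → (∑ i, E i xt) - ∑ i, c m i (xt i) =
      (∏ k ∈ Finset.Icc (r + 1) m, lam k) * ((∑ i, E i xt) - ∑ i, c r i (xt i)) := by
    intro m hm
    induction m, hm using Nat.le_induction with
    | base => simp
    | succ m hm ih =>
      intro h
      have h0 := ih (by omega)
      have h1 : ∑ i, c (m + 1) i (xt i) = _ := (Finset.sum_congr rfl fun i _ =>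
        le_antisymm (hle m i xt) (hmin m (by omega) h i (xt i))).trans (htot m xt)
      rw [Finset.prod_Icc_succ_top (by omega), h1]
      linear_combination lam (m + 1) * h0
  have hfin := hdiff k₂ (by omega) le_rfl
  rw [← hP] at hfin
  have hE0 : Estar ≤ ∑ i, E i xt := by
    rw [hEstar]
    exact ciInf_le (bdd (fun x : ∀ i, D i => ∑ i, E i x)) xt
  have hlow : ∑ i, c k₂ i (xt i) ≤ Estar := by
    rw [hEstar]
    refine le_ciInf fun x => le_trans ?_ (hS k₂ x)
    obtain ⟨m, rfl⟩ : ∃ m, k₂ = m + 1 := ⟨k₂ - 1, by omega⟩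
    exact Finset.sum_le_sum fun i _ =>
      (hle m i xt).trans (hmin m hk₁k₂ le_rfl i (x i))
  have hr : ∑ i, (⨅ a : D i, c r i a) ≤ ∑ i, c r i (xt i) :=
    Finset.sum_le_sum fun i _ => ciInf_le (bdd _) (xt i)
  have hl : ∀ k ∈ Finset.Icc (r + 1) k₂, 0 ≤ lam k ∧ lam k < 1 := fun k hk =>
    hlam k (by have := (Finset.mem_Icc.1 hk).1; omega)
  have hP0 : 0 ≤ P := hP ▸ Finset.prod_nonneg fun k hk => (hl k hk).1
  have hP1 : P < 1 := by
    have hmem : r + 1 ∈ Finset.Icc (r + 1) k₂ := Finset.mem_Icc.2 ⟨le_rfl, hk₁k₂⟩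
    rw [hP, ← Finset.mul_prod_erase _ _ hmem]
    have h1 : ∏ k ∈ (Finset.Icc (r + 1) k₂).erase (r + 1), lam k ≤ 1 :=
      Finset.prod_le_one (fun k hk => (hl k (Finset.mem_of_mem_erase hk)).1)
        fun k hk => (hl k (Finset.mem_of_mem_erase hk)).2.le
    have h2 := mul_le_mul_of_nonneg_left h1 (hl _ hmem).1
    linarith [(hl _ hmem).2]
  refine ⟨by linarith, ?_⟩
  rw [div_mul_eq_mul_div, le_div_iff₀ (by linarith)]
  have := mul_le_mul_of_nonneg_left hr hP0
  nlinarith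
end

section
/- Suppose the cooperative optimization iterates are started from c^{(0)} = 0, suppose there exist ε > 0 and a step k₁ ≥ 1 such that 1 − λ_k ≥ ε for all k ≥ k₁, and suppose a single assignment x̃ is a consensus solution at every step k ≥ k₁. Then x̃ is a global optimum: E(x̃) = E*. -/
/-- Started from `c⁽⁰⁾ = 0`, if there are `ε > 0` and `k₁ ≥ 1` with
`1 − λ_k ≥ ε` for all `k ≥ k₁`, and a single assignment `x̃` is a consensus solution at
every step `k ≥ k₁`, then `x̃` is a global optimum: `E(x̃) = E*`. -/
theorem stmt_5
    (n : ℕ) (hn : 1 ≤ n)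
    (D : Fin n → Type) [∀ i, Fintype (D i)] [∀ i, Nonempty (D i)]
    (E : Fin n → (∀ i, D i) → ℝ)
    (hE : ∀ i x, 0 ≤ E i x)
    (W : Matrix (Fin n) (Fin n) ℝ)
    (hWnn : ∀ i j, 0 ≤ W i j)
    (hWcol : ∀ j, ∑ i, W i j = 1)
    (hWirr : ∀ i j, ∃ k, 0 < (W ^ k) i j)
    (lam : ℕ → ℝ)
    (hlam : ∀ k, 1 ≤ k → 0 ≤ lam k ∧ lam k < 1)
    (c : ℕ → ∀ i, D i → ℝ)
    (hc0 : ∀ i a, c 0 i a = 0)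
    (hrec : ∀ k, 1 ≤ k → ∀ i a,
      c k i a = ⨅ x : {x : ∀ j, D j // x i = a},
        ((1 - lam k) * E i x.1 + lam k * ∑ j, W i j * c (k - 1) j (x.1 j)))
    (Estar : ℝ) (hEstar : Estar = ⨅ x : ∀ i, D i, ∑ i, E i x)
    (ε : ℝ) (hε : 0 < ε)
    (k₁ : ℕ) (hk₁ : 1 ≤ k₁)
    (hεlam : ∀ k, k₁ ≤ k → ε ≤ 1 - lam k)
    (xt : ∀ i, D i)
    (hcons : ∀ k, k₁ ≤ k → ∀ i,
      ((1 - lam k) * E i xt + lam k * ∑ j, W i j * c (k - 1) j (xt j)) =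
        ⨅ x : ∀ j, D j,
          ((1 - lam k) * E i x + lam k * ∑ j, W i j * c (k - 1) j (x j))) :
    (∑ i, E i xt) = Estar := by
  have hle : ∀ k, 1 ≤ k → ∀ (x : ∀ j, D j) i, c k i (x i) ≤
      (1 - lam k) * E i x + lam k * ∑ j, W i j * c (k - 1) j (x j) := by
    intro k hk x i
    rw [hrec k hk]
    exact ciInf_le (f := fun y : {y : ∀ j, D j // y i = x i} =>
      ((1 - lam k) * E i y.1 + lam k * ∑ j, W i j * c (k - 1) j (y.1 j)))
      (Set.finite_range _).bddBelow ⟨x, rfl⟩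
  have hge : ∀ k, k₁ ≤ k → ∀ (x : ∀ j, D j) i,
      (1 - lam k) * E i xt + lam k * ∑ j, W i j * c (k - 1) j (xt j) ≤ c k i (x i) := by
    intro k hk x i
    rw [hrec k (hk₁.trans hk), hcons k hk]
    haveI : Nonempty {y : ∀ j, D j // y i = x i} := ⟨⟨x, rfl⟩⟩
    refine le_ciInf fun y => ?_
    exact ciInf_le (f := fun y : ∀ j, D j =>
      ((1 - lam k) * E i y + lam k * ∑ j, W i j * c (k - 1) j (y j)))
      (Set.finite_range _).bddBelow y.1
  have hsum : ∀ k (x : ∀ j, D j),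
      ∑ i, ((1 - lam k) * E i x + lam k * ∑ j, W i j * c (k - 1) j (x j)) =
      (1 - lam k) * ∑ i, E i x + lam k * ∑ j, c (k - 1) j (x j) := by
    intro k x
    rw [Finset.sum_add_distrib, ← Finset.mul_sum, ← Finset.mul_sum, Finset.sum_comm]
    simp_rw [← Finset.sum_mul, hWcol, one_mul]
  have hS1 : ∀ k, 1 ≤ k → ∀ x : ∀ j, D j, ∑ i, c k i (x i) ≤
      (1 - lam k) * ∑ i, E i x + lam k * ∑ j, c (k - 1) j (x j) := by
    intro k hk x
    rw [← hsum]
    exact Finset.sum_le_sum fun i _ => hle k hk x i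
  have hS2 : ∀ k, k₁ ≤ k → ∀ x : ∀ j, D j,
      (1 - lam k) * ∑ i, E i xt + lam k * ∑ j, c (k - 1) j (xt j) ≤ ∑ i, c k i (x i) := by
    intro k hk x
    rw [← hsum]
    exact Finset.sum_le_sum fun i _ => hge k hk x i
  have key : ∀ x : ∀ j, D j, ∑ i, E i xt ≤ ∑ i, E i x := by
    intro x
    by_contra! hlt
    have hd : ∀ k, k₁ ≤ k → ∑ i, c k i (xt i) ≤ ∑ i, c k i (x i) := fun k hk =>
      (hS1 k (hk₁.trans hk) xt).trans (hS2 k hk x)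
    have hdec : ∀ m : ℕ, ∑ i, c (k₁ + m) i (x i) - ∑ i, c (k₁ + m) i (xt i) ≤
        (∑ i, c k₁ i (x i) - ∑ i, c k₁ i (xt i)) -
          m * (ε * (∑ i, E i xt - ∑ i, E i x)) := by
      intro m
      induction m with
      | zero => simp
      | succ m ih =>
        have h1 := hS1 (k₁ + (m + 1)) (by omega) x
        have h2 := hS2 (k₁ + (m + 1)) (by omega) xt
        have h3 := hd (k₁ + m) (by omega)
        have h4 := hlam (k₁ + (m + 1)) (by omega)
        have h5 := hεlam (k₁ + (m + 1)) (by omega)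
        have e : k₁ + (m + 1) - 1 = k₁ + m := by omega
        rw [e] at h1 h2
        have h6 := mul_le_mul_of_nonneg_right h5 (sub_nonneg.2 hlt.le)
        have h7 := mul_le_mul_of_nonneg_right h4.2.le (sub_nonneg.2 h3)
        push_cast
        linarith
    have hpos : 0 < ε * (∑ i, E i xt - ∑ i, E i x) := mul_pos hε (sub_pos.2 hlt)
    obtain ⟨m, hm⟩ := exists_nat_gt
      ((∑ i, c k₁ i (x i) - ∑ i, c k₁ i (xt i)) / (ε * (∑ i, E i xt - ∑ i, E i x)))
    rw [div_lt_iff₀ hpos] at hm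
    have h1 := hdec m
    have h2 := hd (k₁ + m) (by omega)
    linarith
  rw [hEstar]
  exact le_antisymm (le_ciInf key) (ciInf_le (Set.finite_range _).bddBelow xt)
end

section
/- Let W be a symmetric propagation matrix and λ ∈ [0,1) a constant cooperation strength. Then the cooperative update operator T is a λ-Lipschitz contraction in the sup norm: for all families c, c' (with c_i, c'_i : D i → ℝ), ‖T c − T c'‖_∞ ≤ λ · ‖c − c'‖_∞, where ‖c‖_∞ = max over i and a ∈ D i of |c_i(a)|. -/
/-- For a symmetric propagation matrix `W` and constant `λ ∈ [0,1)`,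
the cooperative update operator `T` is a `λ`-contraction in the sup norm
`‖c‖_∞ = max_{i, a} |cᵢ(a)|`. -/
theorem stmt_6
    (n : ℕ) (hn : 1 ≤ n)
    (D : Fin n → Type) [∀ i, Fintype (D i)] [∀ i, Nonempty (D i)]
    (E : Fin n → (∀ i, D i) → ℝ)
    (hE : ∀ i x, 0 ≤ E i x)
    (W : Matrix (Fin n) (Fin n) ℝ)
    (hWnn : ∀ i j, 0 ≤ W i j)
    (hWcol : ∀ j, ∑ i, W i j = 1)
    (hWirr : ∀ i j, ∃ k, 0 < (W ^ k) i j)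
    (hWsymm : W.IsSymm)
    (lam : ℝ) (hlam : 0 ≤ lam ∧ lam < 1)
    (T : (∀ i, D i → ℝ) → (∀ i, D i → ℝ))
    (hT : ∀ c i a,
      T c i a = ⨅ x : {x : ∀ j, D j // x i = a},
        ((1 - lam) * E i x.1 + lam * ∑ j, W i j * c j (x.1 j))) :
    ∀ c c' : ∀ i, D i → ℝ,
      (⨆ p : Σ i, D i, |T c p.1 p.2 - T c' p.1 p.2|) ≤
        lam * ⨆ p : Σ i, D i, |c p.1 p.2 - c' p.1 p.2| := by
  classical
  intro c c'
  have : Nonempty (Σ i, D i) := ⟨⟨⟨0, hn⟩, Classical.arbitrary _⟩⟩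
  have hrow : ∀ i, ∑ j, W i j = 1 := by
    intro i
    rw [← hWcol i]
    exact Finset.sum_congr rfl fun j _ => hWsymm.apply j i
  have key : ∀ (c c' : ∀ i, D i → ℝ) (M : ℝ), (∀ i a, c i a - c' i a ≤ M) →
      ∀ i a, T c i a - T c' i a ≤ lam * M := by
    intro c c' M hM i a
    have : Nonempty {x : ∀ j, D j // x i = a} :=
      ⟨⟨Function.update (fun j => Classical.arbitrary (D j)) i a, by simp⟩⟩
    have h : T c i a - lam * M ≤ T c' i a := by
      rw [hT c' i a]
      apply le_ciInf
      intro x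
      have h1 : T c i a ≤ (1 - lam) * E i x.1 + lam * ∑ j, W i j * c j (x.1 j) := by
        rw [hT c i a]
        exact ciInf_le (Set.finite_range _).bddBelow x
      have h2 : ∑ j, W i j * c j (x.1 j) ≤ ∑ j, W i j * c' j (x.1 j) + M := by
        calc ∑ j, W i j * c j (x.1 j) ≤ ∑ j, (W i j * c' j (x.1 j) + W i j * M) := by
              apply Finset.sum_le_sum
              intro j _
              nlinarith [mul_le_mul_of_nonneg_left (hM j (x.1 j)) (hWnn i j)]
          _ = _ := by rw [Finset.sum_add_distrib, ← Finset.sum_mul, hrow, one_mul]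
      have h3 := mul_le_mul_of_nonneg_left h2 hlam.1
      linarith
    linarith
  have hb : ∀ i a, |c i a - c' i a| ≤ ⨆ p : Σ i, D i, |c p.1 p.2 - c' p.1 p.2| :=
    fun i a => le_ciSup (f := fun p : Σ i, D i => |c p.1 p.2 - c' p.1 p.2|)
      (Set.finite_range _).bddAbove ⟨i, a⟩
  apply ciSup_le
  intro p
  rw [abs_le']
  refine ⟨key c c' _ (fun i a => (le_abs_self _).trans (hb i a)) _ _, ?_⟩
  rw [neg_sub]
  refine key c' c _ (fun i a => ?_) _ _
  refine le_trans ?_ (hb i a)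
  rw [abs_sub_comm]
  exact le_abs_self _
end

section
/- Let W be a symmetric propagation matrix and λ ∈ [0,1) a constant cooperation strength. Then the system of difference equations c_i(a) = min over assignments x with x i = a of ((1 − λ)·E_i(x) + λ·Σ_j W i j · c_j(x j)) has exactly one solution; that is, the cooperative update operator T has a unique fixed point c^{(∞)}. -/
/-- For a symmetric propagation matrix `W` and constant `λ ∈ [0,1)`,
the system of difference equations `c = T c` has exactly one solution, i.e. the
cooperative update operator `T` has a unique fixed point `c⁽∞⁾`. -/
theorem stmt_7
    (n : ℕ) (hn : 1 ≤ n)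
    (D : Fin n → Type) [∀ i, Fintype (D i)] [∀ i, Nonempty (D i)]
    (E : Fin n → (∀ i, D i) → ℝ)
    (hE : ∀ i x, 0 ≤ E i x)
    (W : Matrix (Fin n) (Fin n) ℝ)
    (hWnn : ∀ i j, 0 ≤ W i j)
    (hWcol : ∀ j, ∑ i, W i j = 1)
    (hWirr : ∀ i j, ∃ k, 0 < (W ^ k) i j)
    (hWsymm : W.IsSymm)
    (lam : ℝ) (hlam : 0 ≤ lam ∧ lam < 1)
    (T : (∀ i, D i → ℝ) → (∀ i, D i → ℝ))
    (hT : ∀ c i a,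
      T c i a = ⨅ x : {x : ∀ j, D j // x i = a},
        ((1 - lam) * E i x.1 + lam * ∑ j, W i j * c j (x.1 j))) :
    ∃! cinf : ∀ i, D i → ℝ, T cinf = cinf := by
  classical
  obtain ⟨h0, h1⟩ := hlam
  have hrow : ∀ i, ∑ j, W i j = 1 := by
    intro i
    rw [← hWcol i]
    exact Finset.sum_congr rfl fun j _ => (hWsymm.apply i j).symm
  have key : ∀ c d i a, T c i a ≤ T d i a + lam * dist c d := by
    intro c d i a
    haveI : Nonempty {x : ∀ j, D j // x i = a} :=
      ⟨⟨Function.update (fun j => Classical.arbitrary (D j)) i a, by simp⟩⟩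
    rw [hT c, hT d, ← sub_le_iff_le_add]
    refine le_ciInf fun x => ?_
    rw [sub_le_iff_le_add]
    refine (ciInf_le (Set.finite_range _).bddBelow x).trans ?_
    have hs : ∑ j, W i j * c j (x.1 j) ≤ ∑ j, W i j * d j (x.1 j) + dist c d := by
      calc ∑ j, W i j * c j (x.1 j)
          ≤ ∑ j, (W i j * d j (x.1 j) + W i j * dist c d) := by
            refine Finset.sum_le_sum fun j _ => ?_
            rw [← mul_add]
            refine mul_le_mul_of_nonneg_left ?_ (hWnn i j)
            have e1 := dist_le_pi_dist c d j
            have e2 := dist_le_pi_dist (c j) (d j) (x.1 j)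
            rw [Real.dist_eq] at e2
            have e3 := le_abs_self (c j (x.1 j) - d j (x.1 j))
            linarith
        _ = _ := by rw [Finset.sum_add_distrib, ← Finset.sum_mul, hrow, one_mul]
    have := mul_le_mul_of_nonneg_left hs h0
    linarith
  have hdist : ∀ c d, dist (T c) (T d) ≤ lam * dist c d := by
    intro c d
    have hn0 : 0 ≤ lam * dist c d := mul_nonneg h0 dist_nonneg
    refine (dist_pi_le_iff hn0).2 fun i => (dist_pi_le_iff hn0).2 fun a => ?_
    rw [Real.dist_eq, abs_le]
    have k1 := key c d i a
    have k2 := key d c i a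
    rw [dist_comm d c] at k2
    constructor <;> linarith
  have hc : ContractingWith ⟨lam, h0⟩ T :=
    ⟨by exact_mod_cast h1, LipschitzWith.of_dist_le_mul hdist⟩
  exact ⟨hc.fixedPoint T, hc.fixedPoint_isFixedPt, fun y hy => hc.fixedPoint_unique hy⟩
end

section
/- Suppose the cooperative optimization iterates are started from c^{(0)} = 0, and let x* be a global optimum of E (i.e., E(x*) = E*). Then for every iteration step k ≥ 1 and every variable index i, c^{(k)}_i(x* i) ≤ (E* − E*_-^{(k)}) + min_{a ∈ D i} c^{(k)}_i(a). -/
/-- Started from `c⁽⁰⁾ = 0`, if `x*` is a global optimum of `E`, then for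
every `k ≥ 1` and every variable index `i`,
`c⁽ᵏ⁾ᵢ(x*ᵢ) ≤ (E* − E*₋⁽ᵏ⁾) + min_{a ∈ D i} c⁽ᵏ⁾ᵢ(a)`. -/
theorem stmt_9
    (n : ℕ) (hn : 1 ≤ n)
    (D : Fin n → Type) [∀ i, Fintype (D i)] [∀ i, Nonempty (D i)]
    (E : Fin n → (∀ i, D i) → ℝ)
    (hE : ∀ i x, 0 ≤ E i x)
    (W : Matrix (Fin n) (Fin n) ℝ)
    (hWnn : ∀ i j, 0 ≤ W i j)
    (hWcol : ∀ j, ∑ i, W i j = 1)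
    (hWirr : ∀ i j, ∃ k, 0 < (W ^ k) i j)
    (lam : ℕ → ℝ)
    (hlam : ∀ k, 1 ≤ k → 0 ≤ lam k ∧ lam k < 1)
    (c : ℕ → ∀ i, D i → ℝ)
    (hc0 : ∀ i a, c 0 i a = 0)
    (hrec : ∀ k, 1 ≤ k → ∀ i a,
      c k i a = ⨅ x : {x : ∀ j, D j // x i = a},
        ((1 - lam k) * E i x.1 + lam k * ∑ j, W i j * c (k - 1) j (x.1 j)))
    (Estar : ℝ) (hEstar : Estar = ⨅ x : ∀ i, D i, ∑ i, E i x)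
    (xstar : ∀ i, D i) (hxstar : (∑ i, E i xstar) = Estar) :
    ∀ k, 1 ≤ k → ∀ i,
      c k i (xstar i) ≤
        (Estar - ∑ j, ⨅ a : D j, c k j a) + ⨅ a : D i, c k i a := by
  have hES : 0 ≤ Estar := by
    rw [← hxstar]
    exact Finset.sum_nonneg fun i _ => hE i xstar
  have key : ∀ k, ∑ i, c k i (xstar i) ≤ Estar := by
    intro k
    induction k with
    | zero => simpa [hc0] using hES
    | succ k ih =>
      obtain ⟨h0, h1⟩ := hlam (k + 1) (by omega)
      have hle : ∀ i, c (k + 1) i (xstar i) ≤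
          (1 - lam (k + 1)) * E i xstar
            + lam (k + 1) * ∑ j, W i j * c k j (xstar j) := by
        intro i
        rw [hrec (k + 1) (by omega) i (xstar i)]
        exact ciInf_le (Set.finite_range _).bddBelow
          (⟨xstar, rfl⟩ : {x : ∀ j, D j // x i = xstar i})
      have hsw : ∑ i, ∑ j, W i j * c k j (xstar j) = ∑ j, c k j (xstar j) := by
        rw [Finset.sum_comm]
        refine Finset.sum_congr rfl fun j _ => ?_
        rw [← Finset.sum_mul, hWcol j, one_mul]
      calc ∑ i, c (k + 1) i (xstar i)
          ≤ ∑ i, ((1 - lam (k + 1)) * E i xstar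
            + lam (k + 1) * ∑ j, W i j * c k j (xstar j)) :=
            Finset.sum_le_sum fun i _ => hle i
        _ = (1 - lam (k + 1)) * Estar + lam (k + 1) * ∑ j, c k j (xstar j) := by
            rw [Finset.sum_add_distrib, ← Finset.mul_sum, ← Finset.mul_sum, hsw, hxstar]
        _ ≤ Estar := by nlinarith [mul_le_mul_of_nonneg_left ih h0]
  intro k _ i
  have hmin : ∀ j, (⨅ a : D j, c k j a) ≤ c k j (xstar j) := fun j =>
    ciInf_le (Set.finite_range _).bddBelow (xstar j)
  have hsing := Finset.single_le_sum
    (f := fun j => c k j (xstar j) - ⨅ a : D j, c k j a)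
    (fun j _ => sub_nonneg.mpr (hmin j)) (Finset.mem_univ i)
  rw [Finset.sum_sub_distrib] at hsing
  have := key k
  linarith
end

section
/- Take the propagation matrix W = (1/n)·J, where J is the all-ones n×n matrix, and start the iterates from c^{(0)} = 0. Let x* be a global optimum of E (i.e., E(x*) = E*). Then for every iteration step k ≥ 1 and every variable index i, c^{(k)}_i(x* i) ≤ E*/n + sqrt((n−1)/n) · (1 − λ_k) · E*. -/
/-- With the propagation matrix `W = (1/n)·J` (`J` the all-ones matrix)
and `c⁽⁰⁾ = 0`, if `x*` is a global optimum of `E`, then for every `k ≥ 1` and every `i`,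
`c⁽ᵏ⁾ᵢ(x*ᵢ) ≤ E*/n + sqrt((n−1)/n) · (1 − λ_k) · E*`. -/
theorem stmt_10
    (n : ℕ) (hn : 1 ≤ n)
    (D : Fin n → Type) [∀ i, Fintype (D i)] [∀ i, Nonempty (D i)]
    (E : Fin n → (∀ i, D i) → ℝ)
    (hE : ∀ i x, 0 ≤ E i x)
    (W : Matrix (Fin n) (Fin n) ℝ)
    (hW : ∀ i j, W i j = 1 / n)
    (lam : ℕ → ℝ)
    (hlam : ∀ k, 1 ≤ k → 0 ≤ lam k ∧ lam k < 1)
    (c : ℕ → ∀ i, D i → ℝ)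
    (hc0 : ∀ i a, c 0 i a = 0)
    (hrec : ∀ k, 1 ≤ k → ∀ i a,
      c k i a = ⨅ x : {x : ∀ j, D j // x i = a},
        ((1 - lam k) * E i x.1 + lam k * ∑ j, W i j * c (k - 1) j (x.1 j)))
    (Estar : ℝ) (hEstar : Estar = ⨅ x : ∀ i, D i, ∑ i, E i x)
    (xstar : ∀ i, D i) (hxstar : (∑ i, E i xstar) = Estar) :
    ∀ k, 1 ≤ k → ∀ i,
      c k i (xstar i) ≤
        Estar / n + Real.sqrt ((n - 1) / n) * (1 - lam k) * Estar := by
  have hn0 : (0 : ℝ) < n := by exact_mod_cast hn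
  have hstep : ∀ k, 1 ≤ k → ∀ i, c k i (xstar i) ≤
      (1 - lam k) * E i xstar + lam k * ((∑ j, c (k - 1) j (xstar j)) / n) := by
    intro k hk i
    rw [hrec k hk i]
    have hb : BddBelow (Set.range (fun x : {x : ∀ j, D j // x i = xstar i} =>
        ((1 - lam k) * E i x.1 + lam k * ∑ j, W i j * c (k - 1) j (x.1 j)))) :=
      (Set.finite_range _).bddBelow
    refine (ciInf_le hb ⟨xstar, rfl⟩).trans (le_of_eq ?_)
    simp only [hW]
    rw [← Finset.mul_sum]
    ring
  have hE0 : 0 ≤ Estar := by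
    rw [← hxstar]
    exact Finset.sum_nonneg fun i _ => hE i xstar
  have hS : ∀ k, ∑ j, c k j (xstar j) ≤ Estar := by
    intro k
    induction k with
    | zero => simpa [hc0] using hE0
    | succ k ih =>
      obtain ⟨h0, h1⟩ := hlam (k + 1) (by omega)
      have h := Finset.sum_le_sum (s := Finset.univ)
        fun i _ => hstep (k + 1) (by omega) i
      rw [Finset.sum_add_distrib, ← Finset.mul_sum, hxstar] at h
      simp only [Finset.sum_const, Finset.card_univ, Fintype.card_fin, nsmul_eq_mul,
        Nat.add_sub_cancel] at h
      have e : (n : ℝ) * (lam (k + 1) * ((∑ j, c k j (xstar j)) / n))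
          = lam (k + 1) * ∑ j, c k j (xstar j) := by
        field_simp
      rw [e] at h
      have := mul_le_mul_of_nonneg_left ih h0
      linarith
  intro k hk i
  obtain ⟨h0, h1⟩ := hlam k hk
  have h := hstep k hk i
  have h2 : lam k * ((∑ j, c (k - 1) j (xstar j)) / n) ≤ lam k * (Estar / n) :=
    mul_le_mul_of_nonneg_left (div_le_div_of_nonneg_right (hS _) hn0.le) h0
  have hEi : E i xstar ≤ Estar := by
    rw [← hxstar]
    exact Finset.single_le_sum (f := fun i => E i xstar) (fun i _ => hE i xstar)
      (Finset.mem_univ i)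
  have hn1 : (1 : ℝ) ≤ n := by exact_mod_cast hn
  have hq0 : (0 : ℝ) ≤ ((n : ℝ) - 1) / n := div_nonneg (by linarith) hn0.le
  have hq1 : ((n : ℝ) - 1) / n ≤ 1 := by
    rw [div_le_one hn0]; linarith
  have hsq : ((n : ℝ) - 1) / n ≤ Real.sqrt (((n : ℝ) - 1) / n) := by
    apply Real.le_sqrt_of_sq_le
    nlinarith
  have h3 : ((n : ℝ) - 1) / n * Estar ≤ Real.sqrt (((n : ℝ) - 1) / n) * Estar :=
    mul_le_mul_of_nonneg_right hsq hE0
  have h4 : ((n : ℝ) - 1) / n * Estar = Estar - Estar / n := by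
    field_simp
  have h5 : (1 - lam k) * (E i xstar - Estar / n) ≤
      (1 - lam k) * (Real.sqrt (((n : ℝ) - 1) / n) * Estar) :=
    mul_le_mul_of_nonneg_left (by linarith) (by linarith)
  linarith
end
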